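/- Let K4 be the complete graph on 4 vertices, with edge set {e1,...,e6}, and let ψ(α1,...,α6) = Σ_T Π_{e∉T} α_e be its Kirchhoff polynomial, the sum over all 16 spanning trees T of K4 of the product of the variables α_e over the edges e not in T. Then the integral ∫_{(0,∞)^5} ψ(α1,α2,α3,α4,α5,1)^{-2} dα1 dα2 dα3 dα4 dα5 is absolutely convergent and equals 6·ζ(3). -/

import Mathlib

open MeasureTheory SimpleGraph Finset

noncomputable section

open Classical in
/-- The Kirchhoff (first Symanzik) polynomial, as a real-valued function, of the
graph whose edges are listed by `ed : Fin m → Sym2 V`: the sum over all (index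
sets of) spanning trees `S` of the product of the variables `x i` over `i ∉ S`. -/
def psiI {V : Type} [Fintype V] [DecidableEq V] {m : ℕ}
    (ed : Fin m → Sym2 V) (x : Fin m → ℝ) : ℝ :=
  ∑ S : Finset (Fin m),
    if (SimpleGraph.fromEdgeSet (↑(S.image ed) : Set (Sym2 V))).IsTree then
      ∏ i ∈ Sᶜ, x i
    else 0

open Classical in
/-- The second Symanzik polynomial with marked vertices `u`, `v`, as a real-valued
function: the sum over all (index sets of) spanning 2-forests (acyclic spanning
subgraphs with exactly two connected components) separating `u` from `v`, of the
product of the variables `x i` over the complementary indices. -/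
def phiI {V : Type} [Fintype V] [DecidableEq V] {m : ℕ}
    (ed : Fin m → Sym2 V) (u v : V) (x : Fin m → ℝ) : ℝ :=
  ∑ S : Finset (Fin m),
    if ((SimpleGraph.fromEdgeSet (↑(S.image ed) : Set (Sym2 V))).IsAcyclic ∧
        Nat.card (SimpleGraph.fromEdgeSet (↑(S.image ed) : Set (Sym2 V))).ConnectedComponent = 2 ∧
        ¬ (SimpleGraph.fromEdgeSet (↑(S.image ed) : Set (Sym2 V))).Reachable u v) then
      ∏ i ∈ Sᶜ, x i
    else 0

/-- The open positive orthant `(0, ∞)^m`. -/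
def posOrthant (m : ℕ) : Set (Fin m → ℝ) := Set.univ.pi fun _ => Set.Ioi 0

/-- The list of the six edges of the complete graph `K₄` on `Fin 4`. -/
def edK4 : Fin 6 → Sym2 (Fin 4) :=
  ![s(0, 1), s(0, 2), s(0, 3), s(1, 2), s(1, 3), s(2, 3)]

theorem card_edges (S : Finset (Fin 6)) :
    Nat.card (SimpleGraph.fromEdgeSet (↑(S.image edK4) : Set (Sym2 (Fin 4)))).edgeSet = S.card := by
  have hd : ∀ i, ¬ (edK4 i).IsDiag := by decide
  have hi : Function.Injective edK4 := by decide
  have : (SimpleGraph.fromEdgeSet (↑(S.image edK4) : Set (Sym2 (Fin 4)))).edgeSet = ↑(S.image edK4) := by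
    rw [SimpleGraph.edgeSet_fromEdgeSet]
    ext x
    simp only [Finset.coe_image, Set.mem_sdiff, Set.mem_image, Finset.mem_coe]
    constructor
    · exact fun h => h.1
    · rintro ⟨i, hiS, rfl⟩
      exact ⟨⟨i, hiS, rfl⟩, by simpa using hd i⟩
  rw [this, Nat.card_coe_set_eq, Set.ncard_coe_finset, Finset.card_image_of_injective _ hi]

theorem tree_iff (S : Finset (Fin 6)) :
   (SimpleGraph.fromEdgeSet (↑(S.image edK4) : Set (Sym2 (Fin 4)))).IsTree ↔ (S.card = 3 ∧ S ≠ {0,1,3} ∧ S ≠ {0,2,4} ∧ S ≠ {1,2,5} ∧ S ≠ {3,4,5}) := by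
  rw [SimpleGraph.isTree_iff_connected_and_card, card_edges]
  rw [Nat.card_eq_fintype_card]
  revert S
  decide +kernel

theorem psi_eq (a b c d e : ℝ) : psiI edK4 (Fin.snoc ![a,b,c,d,e] 1) =
   ((a+e)*(b+1)+c*(a+b+e+1)) * d + (c*((a+b)*(e+1)) + (a*b*(e+1)+e*(a+b))) := by
  unfold psiI
  simp only [tree_iff]
  have h : ∀ S : Finset (Fin 6), (#S = 3 ∧ S ≠ {0,1,3} ∧ S ≠ {0,2,4} ∧ S ≠ {1,2,5} ∧ S ≠ {3,4,5}) ↔ 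
     S ∈ ((((((Finset.powersetCard 3 Finset.univ).erase {0,1,3}).erase {0,2,4}).erase {1,2,5}).erase {3,4,5} : Finset (Finset (Fin 6)))) := by
    intro S; simp; tauto
  simp only [h]
  rw [Finset.sum_ite_mem, Finset.univ_inter]
  have h2 : (((((Finset.powersetCard 3 Finset.univ).erase {0,1,3}).erase {0,2,4}).erase {1,2,5}).erase {3,4,5} : Finset (Finset (Fin 6))) = 
    {{0,1,2},{0,1,4},{0,1,5},{0,2,3},{0,2,5},{0,3,4},{0,3,5},{0,4,5},{1,2,3},{1,2,4},{1,3,4},{1,3,5},{1,4,5},{2,3,4},{2,3,5},{2,4,5}} := by decide +kernel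
  rw [h2]
  have p (S T : Finset (Fin 6)) (x : Fin 6 → ℝ) (h : Sᶜ = T) : ∏ i ∈ Sᶜ, x i = ∏ i ∈ T, x i := by rw [h]
  repeat rw [Finset.sum_insert (by decide +kernel)]
  rw [Finset.sum_singleton]
  rw [p {0,1,2} {3,4,5} _ (by decide), p {0,1,4} {2,3,5} _ (by decide), p {0,1,5} {2,3,4} _ (by decide),
    p {0,2,3} {1,4,5} _ (by decide), p {0,2,5} {1,3,4} _ (by decide), p {0,3,4} {1,2,5} _ (by decide),
    p {0,3,5} {1,2,4} _ (by decide), p {0,4,5} {1,2,3} _ (by decide), p {1,2,3} {0,4,5} _ (by decide),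
    p {1,2,4} {0,3,5} _ (by decide), p {1,3,4} {0,2,5} _ (by decide), p {1,3,5} {0,2,4} _ (by decide),
    p {1,4,5} {0,2,3} _ (by decide), p {2,3,4} {0,1,5} _ (by decide), p {2,3,5} {0,1,4} _ (by decide),
    p {2,4,5} {0,1,3} _ (by decide)]
  have x0 : (Fin.snoc ![a,b,c,d,e] 1 : Fin 6 → ℝ) 0 = a := rfl
  have x1 : (Fin.snoc ![a,b,c,d,e] 1 : Fin 6 → ℝ) 1 = b := rfl
  have x2 : (Fin.snoc ![a,b,c,d,e] 1 : Fin 6 → ℝ) 2 = c := rfl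
  have x3 : (Fin.snoc ![a,b,c,d,e] 1 : Fin 6 → ℝ) 3 = d := rfl
  have x4 : (Fin.snoc ![a,b,c,d,e] 1 : Fin 6 → ℝ) 4 = e := rfl
  have x5 : (Fin.snoc ![a,b,c,d,e] 1 : Fin 6 → ℝ) 5 = 1 := rfl
  have q (i j k : Fin 6) (x : Fin 6 → ℝ) (hij : i ∉ ({j, k} : Finset (Fin 6))) (hjk : j ∉ ({k} : Finset (Fin 6))) : ∏ l ∈ {i,j,k}, x l = x i * (x j * x k) := by 
    rw [Finset.prod_insert hij, Finset.prod_insert hjk, Finset.prod_singleton]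
  repeat rw [q _ _ _ _ (by decide) (by decide)]
  rw [x0,x1,x2,x3,x4,x5]
  ring

theorem ftc_Ioi (f F : ℝ → ℝ) (l : ℝ) (hd : ∀ x ∈ Set.Ici (0:ℝ), HasDerivAt F (f x) x)
    (hp : ∀ x ∈ Set.Ioi (0:ℝ), 0 ≤ f x) (hl : Filter.Tendsto F Filter.atTop (nhds l)) :
    ∫⁻ x in Set.Ioi (0:ℝ), ENNReal.ofReal (f x) = ENNReal.ofReal (l - F 0) := by
  rw [← ofReal_integral_eq_lintegral_ofReal (integrableOn_Ioi_deriv_of_nonneg' hd hp hl),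
    integral_Ioi_of_hasDerivAt_of_nonneg' hd hp hl]
  exact (ae_restrict_iff' measurableSet_Ioi).2 (Filter.Eventually.of_forall hp)

theorem ftc_Ioo (f F : ℝ → ℝ) (a b : ℝ) (hab : a ≤ b) (hc : ContinuousOn F (Set.Icc a b))
    (hd : ∀ x ∈ Set.Ioo a b, HasDerivAt F (f x) x)
    (hp : ∀ x ∈ Set.Ioo a b, 0 ≤ f x) :
    ∫⁻ x in Set.Ioo a b, ENNReal.ofReal (f x) = ENNReal.ofReal (F b - F a) := by
  have hi := intervalIntegral.integrableOn_deriv_of_nonneg hc hd hp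
  have h2 := intervalIntegral.integral_eq_sub_of_hasDerivAt_of_le hab hc hd
    ((intervalIntegrable_iff_integrableOn_Ioc_of_le hab).2 hi)
  rw [← ofReal_integral_eq_lintegral_ofReal (hi.mono_set Set.Ioo_subset_Ioc_self), ← h2,
    intervalIntegral.integral_of_le hab, integral_Ioc_eq_integral_Ioo]
  exact (ae_restrict_iff' measurableSet_Ioo).2 (Filter.Eventually.of_forall hp)

theorem int_sq (m n : ℝ) (hm : 0 < m) (hn : 0 < n) :
    ∫⁻ x in Set.Ioi (0:ℝ), ENNReal.ofReal (((m * x + n) ^ 2)⁻¹) = ENNReal.ofReal ((m * n)⁻¹) := by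
  rw [ftc_Ioi _ (fun x => - (m * (m * x + n))⁻¹) 0]
  · congr 1; simp
  · intro x hx
    have hx : 0 ≤ x := hx
    have h0 : m * (m * x + n) ≠ 0 := by positivity
    have h1 : HasDerivAt (fun x => m * (m * x + n)) (m * m) x := by
      simpa using (((hasDerivAt_id x).const_mul m).add_const n).const_mul m
    convert! (h1.inv h0).neg using 1
    field_simp
  · intro x hx
    positivity
  · rw [← neg_zero]
    apply Filter.Tendsto.neg
    apply Filter.Tendsto.inv_tendsto_atTop
    apply Filter.Tendsto.const_mul_atTop hm
    apply Filter.tendsto_atTop_add_const_right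
    exact Filter.Tendsto.const_mul_atTop hm Filter.tendsto_id

theorem int_two (P Q R S : ℝ) (hP : 0 < P) (hQ : 0 < Q) (hR : 0 < R) (hS : 0 < S)
    (h : P * S < Q * R) :
    ∫⁻ x in Set.Ioi (0:ℝ), ENNReal.ofReal (((P * x + Q) * (R * x + S))⁻¹) =
      ENNReal.ofReal (Real.log (Q * R / (P * S)) / (Q * R - P * S)) := by
  have hne : Q * R - P * S ≠ 0 := by linarith
  rw [ftc_Ioi _ (fun x => (Real.log ((R * x + S) / (P * x + Q))) / (Q * R - P * S))
      (Real.log (R / P) / (Q * R - P * S))]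
  · congr 1
    rw [← sub_div, ← Real.log_div (by positivity) (by simp only [mul_zero, zero_add]; positivity)]
    congr 2
    simp
    field_simp
  · intro x hx
    have hx : 0 ≤ x := hx
    have h0 : P * x + Q ≠ 0 := by positivity
    have h0' : R * x + S ≠ 0 := by positivity
    have h1 : HasDerivAt (fun x => P * x + Q) P x := by
      simpa using (((hasDerivAt_id x).const_mul P).add_const Q)
    have h2 : HasDerivAt (fun x => R * x + S) R x := by
      simpa using (((hasDerivAt_id x).const_mul R).add_const S)
    convert! ((h2.div h1 h0).log (by simp [h0, h0'])).div_const (Q * R - P * S) using 1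
    simp only [Pi.div_apply]
    field_simp
    ring
  · intro x hx
    have hx : 0 < x := hx
    positivity
  · apply Filter.Tendsto.div_const
    apply Filter.Tendsto.log _ (by positivity)
    have e : (fun x : ℝ => (R + S * x⁻¹) / (P + Q * x⁻¹)) =ᶠ[Filter.atTop] (fun x => (R * x + S) / (P * x + Q)) := by
      filter_upwards [Filter.eventually_gt_atTop 0] with x hx
      field_simp
    refine Filter.Tendsto.congr' e ?_
    have hz := tendsto_inv_atTop_zero (𝕜 := ℝ)
    have := ((hz.const_mul S).const_add R).div ((hz.const_mul Q).const_add P) (by simp; positivity)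
    simp only [mul_zero, add_zero] at this
    exact this

theorem int_log (m : ℕ) :
    ∫⁻ x in Set.Ioo (0:ℝ) 1, ENNReal.ofReal (x ^ m * (- Real.log x)) =
      ENNReal.ofReal (1 / ((m:ℝ) + 1) ^ 2) := by
  rw [ftc_Ioo _ (fun x => x ^ (m+1) / ((m:ℝ)+1)^2 - x ^ m * (x * Real.log x) / ((m:ℝ)+1)) 0 1 zero_le_one]
  · congr 1; simp
  · apply Continuous.continuousOn
    have := Real.continuous_mul_log
    fun_prop
  · intro x hx
    have hx0 : x ≠ 0 := hx.1.ne'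
    have h1 : HasDerivAt (fun x : ℝ => x ^ (m+1) / ((m:ℝ)+1)^2) (((m:ℝ)+1) * x ^ m / ((m:ℝ)+1)^2) x := by
      simpa using (hasDerivAt_pow (m+1) x).div_const (((m:ℝ)+1)^2)
    have h2 : HasDerivAt (fun x : ℝ => x ^ (m+1) * Real.log x / ((m:ℝ)+1)) (( ((m:ℝ)+1) * x ^ m * Real.log x + x^(m+1) * x⁻¹) / ((m:ℝ)+1)) x := by
      simpa using ((hasDerivAt_pow (m+1) x).mul (Real.hasDerivAt_log hx0)).div_const (((m:ℝ)+1))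
    have h3 := h1.sub h2
    convert! h3 using 1
    · ext x; simp; ring
    · field_simp
      ring
  · intro x hx
    have := Real.log_neg hx.1 hx.2
    have := hx.1
    have : 0 < - Real.log x := by linarith
    positivity

theorem corner (r0 r1 s0 s1 b : ℝ) (hr0 : 0 < r0) (hr : r0 < r1) (hs0 : 0 < s0) (hs : s0 < s1) (hb : 0 < b) :
    ∫⁻ x in Set.Ioo r0 r1, ∫⁻ y in Set.Ioo s0 s1, ENNReal.ofReal (((x * y * b + 1) ^ 2)⁻¹) =
     ENNReal.ofReal (Real.log ((1 + b * r0 * s0) * (1 + b * r1 * s1) / ((1 + b * r0 * s1) * (1 + b * r1 * s0))) / b) := by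
  have hr1 : 0 < r1 := hr0.trans hr
  have hs1 : 0 < s1 := hs0.trans hs
  have h1 : ∀ x ∈ Set.Ioo r0 r1, ∫⁻ y in Set.Ioo s0 s1, ENNReal.ofReal (((x * y * b + 1) ^ 2)⁻¹) =
      ENNReal.ofReal (s1 / (1 + b * x * s1) - s0 / (1 + b * x * s0)) := by
    intro x hx
    have hx0 : 0 < x := hr0.trans hx.1
    have hD : ∀ y ∈ Set.Icc s0 s1, HasDerivAt (fun y => y / (1 + b * x * y)) (((x * y * b + 1) ^ 2)⁻¹) y := by
      intro y hy
      have hy0 : 0 < y := hs0.trans_le hy.1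
      have h1 : HasDerivAt (fun y => 1 + b * x * y) (b * x) y := by
        simpa using ((hasDerivAt_id y).const_mul (b * x)).const_add 1
      convert! (hasDerivAt_id y).div h1 (by positivity) using 1
      simp
      field_simp
      ring
    rw [ftc_Ioo _ (fun y => y / (1 + b * x * y)) s0 s1 hs.le]
    · exact fun y hy => (hD y hy).continuousAt.continuousWithinAt
    · exact fun y hy => hD y ⟨hy.1.le, hy.2.le⟩
    · intro y hy; positivity
  rw [setLIntegral_congr_fun measurableSet_Ioo h1]
  have hD : ∀ x ∈ Set.Icc r0 r1, HasDerivAt (fun x => (Real.log (1 + b * x * s1) - Real.log (1 + b * x * s0)) / b)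
      (s1 / (1 + b * x * s1) - s0 / (1 + b * x * s0)) x := by
    intro x hx
    have hx0 : 0 < x := hr0.trans_le hx.1
    have h (s : ℝ) : HasDerivAt (fun x => 1 + b * x * s) (b * s) x := by
      simpa using (((hasDerivAt_id x).const_mul b).mul_const s).const_add 1
    convert! (((h s1).log (by positivity)).sub ((h s0).log (by positivity))).div_const b using 1
    field_simp
  rw [ftc_Ioo _ _ r0 r1 hr.le (fun y hy => (hD y hy).continuousAt.continuousWithinAt) (fun y hy => hD y ⟨hy.1.le, hy.2.le⟩)]
  · rw [Real.log_div (by positivity) (by positivity), Real.log_mul (by positivity) (by positivity), Real.log_mul (by positivity) (by positivity)]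
    congr 1
    ring
  · intro x hx
    have hx0 : 0 < x := hr0.trans hx.1
    rw [sub_nonneg, div_le_div_iff₀ (by positivity) (by positivity)]
    nlinarith

theorem int_inv (r0 r1 : ℝ) (hr0 : 0 < r0) (hr : r0 < r1) :
    ∫⁻ x in Set.Ioo r0 r1, ENNReal.ofReal (x⁻¹) = ENNReal.ofReal (Real.log (r1 / r0)) := by
  have hD : ∀ x ∈ Set.Icc r0 r1, HasDerivAt Real.log x⁻¹ x := fun x hx => Real.hasDerivAt_log (hr0.trans_le hx.1).ne'
  rw [ftc_Ioo _ _ r0 r1 hr.le (fun y hy => (hD y hy).continuousAt.continuousWithinAt) (fun y hy => hD y ⟨hy.1.le, hy.2.le⟩)]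
  · rw [Real.log_div (hr0.trans hr).ne' hr0.ne']
  · intro x hx
    have hx0 : 0 < x := hr0.trans hx.1
    positivity

theorem int_corner (r0 r1 s0 s1 : ℝ) (hr0 : 0 < r0) (hr : r0 < r1) (hs0 : 0 < s0) (hs : s0 < s1) :
    ∫⁻ b in Set.Ioi (0:ℝ), ENNReal.ofReal (Real.log ((1 + b * r0 * s0) * (1 + b * r1 * s1) / ((1 + b * r0 * s1) * (1 + b * r1 * s0))) / b)
     = ENNReal.ofReal (Real.log (r1 / r0) * Real.log (s1 / s0)) := by
  rw [setLIntegral_congr_fun measurableSet_Ioi (fun b hb => (corner r0 r1 s0 s1 b hr0 hr hs0 hs hb).symm)]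
  rw [lintegral_lintegral_swap]
  swap
  · apply Measurable.aemeasurable
    apply Measurable.lintegral_prod_right
    fun_prop
  have h1 : ∀ x ∈ Set.Ioo r0 r1, ∫⁻ b in Set.Ioi (0:ℝ), ∫⁻ y in Set.Ioo s0 s1, ENNReal.ofReal (((x * y * b + 1) ^ 2)⁻¹) = ENNReal.ofReal (x⁻¹) * ENNReal.ofReal (Real.log (s1 / s0)) := by
    intro x hx
    have hx0 : 0 < x := hr0.trans hx.1
    rw [lintegral_lintegral_swap (by fun_prop)]
    rw [← int_inv s0 s1 hs0 hs, ← lintegral_const_mul _ (by fun_prop)]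
    apply setLIntegral_congr_fun measurableSet_Ioo
    intro y hy
    have hy0 : 0 < y := hs0.trans hy.1
    show ∫⁻ b in Set.Ioi (0:ℝ), ENNReal.ofReal (((x * y * b + 1) ^ 2)⁻¹) = ENNReal.ofReal x⁻¹ * ENNReal.ofReal y⁻¹
    rw [int_sq (x*y) 1 (by positivity) one_pos, ← ENNReal.ofReal_mul (by positivity)]
    congr 1
    field_simp
  rw [setLIntegral_congr_fun measurableSet_Ioo h1, lintegral_mul_const _ (by fun_prop), int_inv r0 r1 hr0 hr, ← ENNReal.ofReal_mul]
  apply Real.log_nonneg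
  rw [le_div_iff₀ hr0]; linarith

theorem summable_tele (c : ℝ) (hc : 0 < c) :
    ∑' k : ℕ, ENNReal.ofReal (1 / ((k + c) * (k + c + 1))) = ENNReal.ofReal (1 / c) := by
  have h : HasSum (fun k : ℕ => 1 / (((k:ℝ) + c) * (k + c + 1))) (1 / c) := by
    rw [hasSum_iff_tendsto_nat_of_nonneg (fun i => by positivity)]
    have e : ∀ n : ℕ, ∑ k ∈ Finset.range n, 1 / (((k:ℝ) + c) * (k + c + 1)) = 1 / c - 1 / (n + c) := by
      intro n
      induction n with
      | zero => simp
      | succ n ih =>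
        rw [Finset.sum_range_succ, ih]
        push_cast
        field_simp
        ring
    simp only [e]
    have : Filter.Tendsto (fun n : ℕ => 1 / ((n:ℝ) + c)) Filter.atTop (nhds 0) := by
      simp only [one_div]
      exact (Filter.tendsto_atTop_add_const_right _ _ tendsto_natCast_atTop_atTop).inv_tendsto_atTop
    simpa using this.const_sub (1 / c)
  rw [← ENNReal.ofReal_tsum_of_nonneg (fun i => by positivity) h.summable, h.tsum_eq]

/-- regrouping a double sum along antidiagonals -/
theorem tsum_antidiag (f : ℕ → ℕ → ENNReal) :
    ∑' i, ∑' j, f i j = ∑' n : ℕ, ∑ p ∈ Finset.HasAntidiagonal.antidiagonal n, f p.1 p.2 := by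
  rw [← ENNReal.tsum_prod (f := f), ← (Finset.HasAntidiagonal.sigmaAntidiagonalEquivProd (A := ℕ)).tsum_eq, ENNReal.tsum_sigma']
  congr 1; ext n
  rw [← Finset.tsum_subtype]
  rfl

theorem tsum_diag1 (g : ℕ → ENNReal) :
    ∑' i, ∑' j, g (i + j) = ∑' n : ℕ, ((n:ENNReal) + 1) * g n := by
  rw [tsum_antidiag (fun i j => g (i + j))]
  congr 1; ext n
  rw [Finset.sum_congr rfl (g := fun _ => g n)]
  · simp
  · intro p hp
    rw [Finset.HasAntidiagonal.mem_antidiagonal.1 hp]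

def zz : ENNReal := ∑' n : ℕ, ENNReal.ofReal (1 / ((n:ℝ) + 1) ^ 3)
def ZZ : ENNReal := ∑' m : ℕ, ∑' l : ℕ, ENNReal.ofReal (1 / (((m:ℝ) + 1) * ((m:ℝ) + l + 2) ^ 2))
def XX : ENNReal := ∑' j : ℕ, ∑' k : ℕ, ENNReal.ofReal (1 / (((j:ℝ) + 1) * ((k:ℝ) + 1) * ((j:ℝ) + k + 2)))

theorem XX_eq : XX = ZZ + ZZ := by
  have h : ∀ j k : ℕ, ENNReal.ofReal (1 / (((j:ℝ) + 1) * ((k:ℝ) + 1) * ((j:ℝ) + k + 2))) =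
     ENNReal.ofReal (1 / (((j:ℝ) + 1) * ((j:ℝ) + k + 2) ^ 2)) + ENNReal.ofReal (1 / (((k:ℝ) + 1) * ((k:ℝ) + j + 2) ^ 2)) := by
    intro j k
    rw [← ENNReal.ofReal_add (by positivity) (by positivity), add_comm (k:ℝ) j]
    congr 1
    field_simp
    ring
  unfold XX
  simp only [h, ENNReal.tsum_add]
  congr 1
  rw [ENNReal.tsum_comm]
  rfl

theorem XX_eq2 : XX = zz + ZZ := by
  have h1 : ∀ j : ℕ, ∑' k : ℕ, ENNReal.ofReal (1 / (((j:ℝ) + 1) * ((k:ℝ) + 1) * ((j:ℝ) + k + 2))) =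
      ∑ i ∈ Finset.range (j+1), ENNReal.ofReal (1 / (((i:ℝ) + 1) * ((j:ℝ) + 1) ^ 2)) := by
    intro j
    have h2 : ∀ k : ℕ, ENNReal.ofReal (1 / (((j:ℝ) + 1) * ((k:ℝ) + 1) * ((j:ℝ) + k + 2))) =
       ∑ i ∈ Finset.range (j+1), ENNReal.ofReal (1 / ((j:ℝ)+1)^2) * ENNReal.ofReal (1 / ((k + ((i:ℝ) + 1)) * (k + ((i:ℝ) + 1) + 1))) := by
      intro k
      rw [← Finset.mul_sum, ← ENNReal.ofReal_sum_of_nonneg (fun i _ => by positivity), ← ENNReal.ofReal_mul (by positivity)]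
      have e : ∀ n : ℕ, ∑ i ∈ Finset.range n, 1 / (((k:ℝ) + ((i:ℝ) + 1)) * (k + ((i:ℝ) + 1) + 1)) = 1 / (k + 1) - 1 / (k + 1 + n) := by
        intro n
        induction n with
        | zero => simp
        | succ n ih =>
          rw [Finset.sum_range_succ, ih]
          push_cast
          field_simp
          ring
      rw [e]
      congr 1
      push_cast
      field_simp
      ring
    simp only [h2]
    rw [Summable.tsum_finsetSum (fun i _ => ENNReal.summable)]
    apply Finset.sum_congr rfl
    intro i _
    rw [ENNReal.tsum_mul_left, summable_tele _ (by positivity), ← ENNReal.ofReal_mul (by positivity)]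
    congr 1
    field_simp
  unfold XX
  simp only [h1, Finset.sum_range_succ, ENNReal.tsum_add]
  rw [add_comm]
  congr 1
  · unfold zz
    congr 1; ext j; congr 1; field_simp
  · unfold ZZ
    rw [tsum_antidiag (fun m l => ENNReal.ofReal (1 / (((m:ℝ) + 1) * ((m:ℝ) + l + 2) ^ 2))), tsum_eq_zero_add' ENNReal.summable]
    simp only [Finset.range_zero, Finset.sum_empty, zero_add]
    congr 1; ext n
    rw [Finset.Nat.sum_antidiagonal_eq_sum_range_succ (fun m l => ENNReal.ofReal (1 / (((m:ℝ) + 1) * ((m:ℝ) + l + 2) ^ 2)))]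
    apply Finset.sum_congr rfl
    intro i hi
    have : i ≤ n := by simpa [Nat.lt_succ_iff] using hi
    push_cast [this]
    congr 4
    ring

theorem ZZ_ne_top : ZZ ≠ ⊤ := by
  have h : ZZ ≤ ∑' m : ℕ, ENNReal.ofReal (1 / ((m:ℝ) + 1) ^ 2) := by
    apply ENNReal.tsum_le_tsum
    intro m
    calc _ ≤ ∑' l : ℕ, ENNReal.ofReal (1 / ((m:ℝ)+1)) * ENNReal.ofReal (1 / ((l + ((m:ℝ)+1)) * (l + ((m:ℝ)+1) + 1))) := by
          apply ENNReal.tsum_le_tsum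
          intro l
          rw [← ENNReal.ofReal_mul (by positivity)]
          apply ENNReal.ofReal_le_ofReal
          rw [div_mul_div_comm, one_mul]
          apply one_div_le_one_div_of_le (by positivity)
          apply mul_le_mul_of_nonneg_left _ (by positivity)
          rw [sq]
          apply mul_le_mul <;> first | positivity | linarith
      _ = _ := by
          rw [ENNReal.tsum_mul_left, summable_tele _ (by positivity), ← ENNReal.ofReal_mul (by positivity)]
          congr 1
          field_simp
  refine ne_top_of_le_ne_top ?_ h
  apply Summable.tsum_ofReal_ne_top
  have := (summable_nat_add_iff 1).2 (Real.summable_one_div_nat_pow.2 (one_lt_two))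
  simpa using this

theorem ZZ_eq : ZZ = zz := by
  have := XX_eq.symm.trans XX_eq2
  exact (ENNReal.add_left_inj ZZ_ne_top).1 this

theorem zz_eq : zz = ENNReal.ofReal (∑' n : ℕ, (1 : ℝ) / (n + 1) ^ 3) := by
  unfold zz
  rw [ENNReal.ofReal_tsum_of_nonneg (fun i => by positivity)]
  have := (summable_nat_add_iff 1).2 (Real.summable_one_div_nat_pow.2 (show 1 < 3 by norm_num))
  simpa using this

/-- splitting a symmetric double sum -/
theorem tsum_tri (f : ℕ → ENNReal) :
    (∑' i, f i) * (∑' i, f i) = ∑' i, f i * f i + 2 * ∑' i, ∑' l, f i * f (i + l + 1) := by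
  have h0 : (∑' i, f i) * (∑' i, f i) = ∑' i, ∑' j, f i * f j := by
    rw [← ENNReal.tsum_mul_right]
    simp only [ENNReal.tsum_mul_left]
  have h1 : ∀ i, ∑' j, f i * f j = ∑ j ∈ Finset.range i, f i * f j + f i * f i + ∑' l, f i * f (i + l + 1) := by
    intro i
    rw [← Finset.sum_range_succ, ← Summable.sum_add_tsum_nat_add' (f := fun j => f i * f j) (k := i+1) ENNReal.summable]
    congr 2; ext l; congr 2; ring
  have h2 : ∑' i, ∑ j ∈ Finset.range i, f i * f j = ∑' i, ∑' l, f i * f (i + l + 1) := by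
    rw [tsum_antidiag (fun i l => f i * f (i + l + 1)), tsum_eq_zero_add' ENNReal.summable]
    simp only [Finset.range_zero, Finset.sum_empty, zero_add]
    congr 1; ext n
    rw [Finset.Nat.sum_antidiagonal_eq_sum_range_succ (fun i l => f i * f (i + l + 1))]
    apply Finset.sum_congr rfl
    intro i hi
    have : i ≤ n := by simpa [Nat.lt_succ_iff] using hi
    rw [show i + (n - i) + 1 = n + 1 by omega, mul_comm]
  rw [h0]
  simp only [h1, ENNReal.tsum_add, h2]
  rw [two_mul]
  abel

theorem final_sum : ∑' n : ℕ, (∑' k : ℕ, ENNReal.ofReal (1 / (((n + k : ℕ):ℝ) + 1) ^ 2)) * (∑' k : ℕ, ENNReal.ofReal (1 / (((n + k : ℕ):ℝ) + 1) ^ 2)) = 3 * zz := by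
  simp only [tsum_tri, ENNReal.tsum_add, ENNReal.tsum_mul_left]
  have c : ∀ n : ℕ, (n:ENNReal) + 1 = ENNReal.ofReal ((n:ℝ) + 1) := by
    intro n
    rw [ENNReal.ofReal_add (by positivity) zero_le_one]; simp
  have a1 : ∑' n : ℕ, ∑' k : ℕ, ENNReal.ofReal (1 / (((n + k : ℕ):ℝ) + 1) ^ 2) * ENNReal.ofReal (1 / (((n + k : ℕ):ℝ) + 1) ^ 2) = zz := by
    rw [tsum_diag1 (fun m => ENNReal.ofReal (1 / ((m:ℝ) + 1) ^ 2) * ENNReal.ofReal (1 / ((m:ℝ) + 1) ^ 2))]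
    unfold zz
    congr 1; ext n
    rw [c, ← ENNReal.ofReal_mul (by positivity), ← ENNReal.ofReal_mul (by positivity)]
    congr 1; field_simp
  have a2 : ∑' n : ℕ, ∑' k : ℕ, ENNReal.ofReal (1 / (((n + k : ℕ):ℝ) + 1) ^ 2) * ∑' l : ℕ, ENNReal.ofReal (1 / (((n + (k + l + 1) : ℕ):ℝ) + 1) ^ 2) = ZZ := by
    have := tsum_diag1 (fun m => ENNReal.ofReal (1 / ((m:ℝ) + 1) ^ 2) * ∑' l : ℕ, ENNReal.ofReal (1 / (((m + l + 1 : ℕ):ℝ) + 1) ^ 2))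
    simp only [← add_assoc] at this ⊢
    rw [this]
    unfold ZZ
    congr 1; ext n
    rw [c, ← mul_assoc, ← ENNReal.ofReal_mul (by positivity), ← ENNReal.tsum_mul_left]
    congr 1; ext l
    rw [← ENNReal.ofReal_mul (by positivity)]
    congr 1; push_cast; field_simp; ring
  rw [a1, a2, ZZ_eq]
  ring

theorem sub_scale (k : ℝ) (hk : 0 < k) (g : ℝ → ENNReal) :
    ∫⁻ a in Set.Ioi (0:ℝ), g a = ∫⁻ u in Set.Ioi (0:ℝ), ENNReal.ofReal k * g (k * u) := by
  have h := lintegral_image_eq_lintegral_abs_deriv_mul (s := Set.Ioi (0:ℝ)) (f := fun u => k * u) (f' := fun _ => k)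
    measurableSet_Ioi (fun x _ => by simpa using ((hasDerivAt_id x).const_mul k).hasDerivWithinAt)
    (fun x _ y _ h => mul_left_cancel₀ hk.ne' h) g
  rw [abs_of_pos hk] at h
  rw [← h]
  congr 2
  ext x
  simp only [Set.mem_image, Set.mem_Ioi]
  constructor
  · intro hx
    exact ⟨x / k, by positivity, by field_simp⟩
  · rintro ⟨y, hy, rfl⟩
    positivity

theorem sub_scale01 (k : ℝ) (hk : 0 < k) (g : ℝ → ENNReal) :
    ∫⁻ a in Set.Ioo (0:ℝ) k, g a = ∫⁻ u in Set.Ioo (0:ℝ) 1, ENNReal.ofReal k * g (k * u) := by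
  have h := lintegral_image_eq_lintegral_abs_deriv_mul (s := Set.Ioo (0:ℝ) 1) (f := fun u => k * u) (f' := fun _ => k)
    measurableSet_Ioo (fun x _ => by simpa using ((hasDerivAt_id x).const_mul k).hasDerivWithinAt)
    (fun x _ y _ h => mul_left_cancel₀ hk.ne' h) g
  rw [abs_of_pos hk] at h
  rw [← h]
  congr 2
  ext x
  simp only [Set.mem_image, Set.mem_Ioo]
  constructor
  · rintro ⟨hx, hx1⟩
    exact ⟨x / k, ⟨by positivity, by rwa [div_lt_one hk]⟩, by field_simp⟩
  · rintro ⟨y, ⟨hy, hy1⟩, rfl⟩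
    exact ⟨by positivity, by nlinarith⟩

theorem sub_inv (g : ℝ → ENNReal) :
    ∫⁻ a in Set.Ioi (1:ℝ), g a = ∫⁻ u in Set.Ioo (0:ℝ) 1, ENNReal.ofReal ((u ^ 2)⁻¹) * g (u⁻¹) := by
  have h := lintegral_image_eq_lintegral_abs_deriv_mul (s := Set.Ioo (0:ℝ) 1) (f := fun u => u⁻¹) (f' := fun u => -(u^2)⁻¹)
    measurableSet_Ioo (fun x hx => (hasDerivAt_inv hx.1.ne').hasDerivWithinAt)
    (fun x _ y _ h => inv_injective h) g
  simp only [abs_neg, abs_inv, abs_pow, sq_abs] at h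
  rw [← h]
  congr 2
  ext x
  simp only [Set.mem_image, Set.mem_Ioo, Set.mem_Ioi]
  constructor
  · rintro hx
    exact ⟨x⁻¹, ⟨by positivity, inv_lt_one_of_one_lt₀ hx⟩, by simp⟩
  · rintro ⟨y, ⟨hy, hy1⟩, rfl⟩
    exact (one_lt_inv₀ hy).2 hy1

theorem sub_r (u : ℝ) (hu : u < 1) (g : ℝ → ENNReal) :
    ∫⁻ e in Set.Ioi (0:ℝ), g e = ∫⁻ r in Set.Ioo u 1, ENNReal.ofReal ((1 - u) / (r - u) ^ 2) * g ((1 - r) / (r - u)) := by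
  have h := lintegral_image_eq_lintegral_abs_deriv_mul (s := Set.Ioo u 1) (f := fun r => (1 - r) / (r - u)) (f' := fun r => -((1 - u) / (r - u) ^ 2))
    measurableSet_Ioo (fun x hx => by
      apply HasDerivAt.hasDerivWithinAt
      have hne : x - u ≠ 0 := by linarith [hx.1]
      convert! ((hasDerivAt_id x).const_sub 1).div ((hasDerivAt_id x).sub_const u) hne using 1
      simp only [id]
      field_simp
      ring)
    (fun x hx y hy h => by
      have h1 : x - u ≠ 0 := by linarith [hx.1]
      have h2 : y - u ≠ 0 := by linarith [hy.1]
      simp only at h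
      rw [div_eq_div_iff h1 h2] at h
      have : (1 - u) * (y - x) = 0 := by linarith
      rcases mul_eq_zero.1 this with h | h <;> linarith) g
  have e : ∀ r, |-((1 - u) / (r - u) ^ 2)| = (1 - u) / (r - u) ^ 2 := by
    intro r
    have : 0 < 1 - u := by linarith
    rw [abs_neg, abs_of_nonneg (by positivity)]
  simp only [e] at h
  rw [← h]
  congr 2
  ext x
  simp only [Set.mem_image, Set.mem_Ioo, Set.mem_Ioi]
  constructor
  · rintro hx
    refine ⟨(1 + x * u) / (x + 1), ⟨?_, ?_⟩, ?_⟩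
    · rw [lt_div_iff₀ (by positivity)]; linarith
    · rw [div_lt_one (by positivity)]; nlinarith
    · have h3 : (1 + x * u) / (x + 1) - u = (1 - u) / (x + 1) := by field_simp; ring
      have h4 : 1 - (1 + x * u) / (x + 1) = x * (1 - u) / (x + 1) := by field_simp; ring
      have : 1 - u ≠ 0 := by linarith
      rw [h3, h4]
      field_simp
  · rintro ⟨y, ⟨hy, hy1⟩, rfl⟩
    apply div_pos <;> linarith

theorem stepE : ∫⁻ r in Set.Ioo (0:ℝ) 1, ∫⁻ s in Set.Ioo (0:ℝ) 1,
    ENNReal.ofReal (Real.log r * Real.log s / ((1 - r * s) * (1 - r) * (1 - s))) = 3 * zz := by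
  have hf : ∀ n : ℕ, ∫⁻ r in Set.Ioo (0:ℝ) 1, ENNReal.ofReal (r ^ n * (- Real.log r) / (1 - r)) =
      ∑' k : ℕ, ENNReal.ofReal (1 / (((n + k : ℕ):ℝ) + 1) ^ 2) := by
    intro n
    simp only [← int_log]
    rw [← lintegral_tsum (fun k => by fun_prop)]
    apply setLIntegral_congr_fun measurableSet_Ioo
    intro r hr
    have hl : 0 < - Real.log r := by linarith [Real.log_neg hr.1 hr.2]
    have h0 := hr.1
    have hs := hasSum_geometric_of_lt_one hr.1.le hr.2
    have hs2 := hs.mul_left (r ^ n * (- Real.log r))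
    have : ∀ k, r ^ n * (- Real.log r) * r ^ k = r ^ (n + k) * (- Real.log r) := by intro k; ring
    simp only [this] at hs2
    show ENNReal.ofReal (r ^ n * (- Real.log r) / (1 - r)) = ∑' k : ℕ, ENNReal.ofReal (r ^ (n + k) * (- Real.log r))
    rw [← ENNReal.ofReal_tsum_of_nonneg (fun i => by positivity) hs2.summable, hs2.tsum_eq]
    rfl
  rw [← final_sum]
  simp only [← hf]
  have h1 : ∀ r ∈ Set.Ioo (0:ℝ) 1, ∀ s ∈ Set.Ioo (0:ℝ) 1,
      ENNReal.ofReal (Real.log r * Real.log s / ((1 - r * s) * (1 - r) * (1 - s))) =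
      ∑' n : ℕ, ENNReal.ofReal (r ^ n * (- Real.log r) / (1 - r)) * ENNReal.ofReal (s ^ n * (- Real.log s) / (1 - s)) := by
    intro r hr s hs
    have hl : 0 < - Real.log r := by linarith [Real.log_neg hr.1 hr.2]
    have hl' : 0 < - Real.log s := by linarith [Real.log_neg hs.1 hs.2]
    have h0 := hr.1
    have h0' := hs.1
    have h1 : 0 < 1 - r := by linarith [hr.2]
    have h1' : 0 < 1 - s := by linarith [hs.2]
    have hg := hasSum_geometric_of_lt_one (r := r * s) (by positivity) (by nlinarith [hr.2, hs.2])
    have hs2 := hg.mul_left ((- Real.log r) / (1 - r) * ((- Real.log s) / (1 - s)))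
    have e : ∀ n : ℕ, ENNReal.ofReal (r ^ n * (- Real.log r) / (1 - r)) * ENNReal.ofReal (s ^ n * (- Real.log s) / (1 - s)) =
        ENNReal.ofReal ((- Real.log r) / (1 - r) * ((- Real.log s) / (1 - s)) * (r * s) ^ n) := by
      intro n
      rw [← ENNReal.ofReal_mul (by positivity)]
      congr 1
      rw [mul_pow]; ring
    simp only [e]
    rw [← ENNReal.ofReal_tsum_of_nonneg (fun i => by positivity) hs2.summable, hs2.tsum_eq]
    congr 1
    have : 1 - r * s ≠ 0 := by nlinarith [hr.2, hs.2]
    field_simp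
  have h2 : ∀ r ∈ Set.Ioo (0:ℝ) 1, ∫⁻ s in Set.Ioo (0:ℝ) 1,
    ENNReal.ofReal (Real.log r * Real.log s / ((1 - r * s) * (1 - r) * (1 - s))) =
     ∑' n : ℕ, ENNReal.ofReal (r ^ n * (- Real.log r) / (1 - r)) * ∫⁻ s in Set.Ioo (0:ℝ) 1, ENNReal.ofReal (s ^ n * (- Real.log s) / (1 - s)) := by
    intro r hr
    rw [setLIntegral_congr_fun measurableSet_Ioo (h1 r hr), lintegral_tsum (fun k => by fun_prop)]
    congr 1; ext n
    rw [lintegral_const_mul _ (by fun_prop)]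
  rw [setLIntegral_congr_fun measurableSet_Ioo h2, lintegral_tsum (fun k => by fun_prop)]
  congr 1; ext n
  rw [lintegral_mul_const _ (by fun_prop)]

theorem swap_tri (G : ℝ → ℝ → ENNReal) (hG : Measurable (Function.uncurry G)) :
    ∫⁻ u in Set.Ioo (0:ℝ) 1, ∫⁻ r in Set.Ioo u 1, G u r = ∫⁻ r in Set.Ioo (0:ℝ) 1, ∫⁻ u in Set.Ioo 0 r, G u r := by
  have hm : MeasurableSet {p : ℝ × ℝ | p.1 < p.2} := measurableSet_lt measurable_fst measurable_snd
  have e1 : ∀ u ∈ Set.Ioo (0:ℝ) 1, ∫⁻ r in Set.Ioo u 1, G u r = ∫⁻ r in Set.Ioo (0:ℝ) 1, {p : ℝ × ℝ | p.1 < p.2}.indicator (Function.uncurry G) (u, r) := by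
    intro u hu
    have : Set.Ioo u 1 = Set.Ioi u ∩ Set.Ioo 0 1 := by
      ext x; simp only [Set.mem_Ioo, Set.mem_inter_iff, Set.mem_Ioi]
      constructor
      · exact fun h => ⟨h.1, hu.1.trans h.1, h.2⟩
      · exact fun h => ⟨h.1, h.2.2⟩
    rw [this, ← setLIntegral_indicator measurableSet_Ioi]
    rfl
  have e2 : ∀ r ∈ Set.Ioo (0:ℝ) 1, ∫⁻ u in Set.Ioo 0 r, G u r = ∫⁻ u in Set.Ioo (0:ℝ) 1, {p : ℝ × ℝ | p.1 < p.2}.indicator (Function.uncurry G) (u, r) := by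
    intro r hr
    have : Set.Ioo 0 r = Set.Iio r ∩ Set.Ioo 0 1 := by
      ext x; simp only [Set.mem_Ioo, Set.mem_inter_iff, Set.mem_Iio]
      constructor
      · exact fun h => ⟨h.2, h.1, h.2.trans hr.2⟩
      · exact fun h => ⟨h.2.1, h.1⟩
    rw [this, ← setLIntegral_indicator measurableSet_Iio]
    rfl
  rw [setLIntegral_congr_fun measurableSet_Ioo e1, setLIntegral_congr_fun measurableSet_Ioo e2]
  rw [lintegral_lintegral_swap]
  exact (hG.indicator hm).aemeasurable

def Phi (u e : ℝ) : ENNReal := ENNReal.ofReal (Real.log ((e * u + 1) / (e + 1)) * Real.log (u / ((e * u + 1) / (e + 1))) / (e * (1 - u) ^ 2))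

theorem D1 (u : ℝ) (hu : u ∈ Set.Ioo (0:ℝ) 1) : ∫⁻ e in Set.Ioi (0:ℝ), Phi u e = 
    ∫⁻ r in Set.Ioo u 1, ENNReal.ofReal (Real.log r * Real.log (u / r) / ((1 - u) * (1 - r) * (r - u))) := by
  rw [sub_r u hu.2]
  apply setLIntegral_congr_fun measurableSet_Ioo
  intro r hr
  have h1 : 0 < 1 - u := by linarith [hu.2]
  have h2 : 0 < r - u := by linarith [hr.1]
  have h3 : 0 < 1 - r := by linarith [hr.2]
  have e1 : (1 - r) / (r - u) * u + 1 = r * (1 - u) / (r - u) := by field_simp; ring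
  have e2 : (1 - r) / (r - u) + 1 = (1 - u) / (r - u) := by field_simp; ring
  have e3 : ((1 - r) / (r - u) * u + 1) / ((1 - r) / (r - u) + 1) = r := by
    rw [e1, e2]; field_simp
  simp only [Phi]
  rw [← ENNReal.ofReal_mul (by positivity), e3]
  congr 1
  field_simp

theorem D2 : ∫⁻ u in Set.Ioo (0:ℝ) 1, ∫⁻ e in Set.Ioi (0:ℝ), Phi u e = 3 * zz := by
  rw [setLIntegral_congr_fun measurableSet_Ioo D1, swap_tri _ (by unfold Function.uncurry; fun_prop), ← stepE]
  apply setLIntegral_congr_fun measurableSet_Ioo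
  intro r hr
  have h0 := hr.1
  simp only
  rw [sub_scale01 r hr.1]
  apply setLIntegral_congr_fun measurableSet_Ioo
  intro s hs
  have h3 : 0 < 1 - r := by linarith [hr.2]
  have h4 : 0 < 1 - s := by linarith [hs.2]
  have h1 : 0 < 1 - r * s := by nlinarith [hr.2, hs.2, hs.1]
  simp only
  rw [← ENNReal.ofReal_mul h0.le, show r * s / r = s by field_simp, show r - r * s = r * (1 - s) by ring]
  congr 1
  field_simp

theorem Phi_inv (v e : ℝ) (hv : 0 < v) (he : 0 < e) (hv1 : v < 1) :
    ENNReal.ofReal ((v ^ 2)⁻¹) * (ENNReal.ofReal v * Phi v⁻¹ (v * e)) = Phi v e := by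
  unfold Phi
  rw [← ENNReal.ofReal_mul (by positivity), ← ENNReal.ofReal_mul (by positivity)]
  have h1 : 0 < 1 - v := by linarith
  have e1 : (v * e * v⁻¹ + 1) / (v * e + 1) = ((e * v + 1) / (e + 1))⁻¹ := by field_simp
  have e2 : v⁻¹ / ((e * v + 1) / (e + 1))⁻¹ = (v / ((e * v + 1) / (e + 1)))⁻¹ := by field_simp
  have e3 : 1 - v⁻¹ = - (1 - v) / v := by field_simp; ring
  rw [e1, e2, Real.log_inv, Real.log_inv, e3]
  congr 1
  field_simp

theorem D3 : ∫⁻ u in Set.Ioi (0:ℝ), ∫⁻ e in Set.Ioi (0:ℝ), Phi u e = 6 * zz := by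
  have h : Set.Ioi (0:ℝ) = Set.Ioc 0 1 ∪ Set.Ioi 1 := (Set.Ioc_union_Ioi_eq_Ioi zero_le_one).symm
  nth_rw 1 [h]
  rw [lintegral_union measurableSet_Ioi (Set.Ioc_disjoint_Ioi le_rfl), setLIntegral_congr Ioo_ae_eq_Ioc.symm, sub_inv]
  have h2 : ∫⁻ u in Set.Ioo (0:ℝ) 1, ENNReal.ofReal ((u ^ 2)⁻¹) * ∫⁻ e in Set.Ioi (0:ℝ), Phi u⁻¹ e = ∫⁻ u in Set.Ioo (0:ℝ) 1, ∫⁻ e in Set.Ioi (0:ℝ), Phi u e := by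
    apply setLIntegral_congr_fun measurableSet_Ioo
    intro v hv
    simp only
    rw [sub_scale v hv.1, ← lintegral_const_mul _ (by unfold Phi; fun_prop)]
    apply setLIntegral_congr_fun measurableSet_Ioi
    intro e he
    exact Phi_inv v e hv.1 he hv.2
  rw [h2, D2, ← add_mul]
  norm_num

def Lb (u b e : ℝ) : ENNReal := ENNReal.ofReal (1 / (e * (1 - u) ^ 2)) *
  ENNReal.ofReal (Real.log ((1 + b * u) * (1 + b) / ((1 + b * ((e * u + 1) / (e + 1))) * (1 + b * (u / ((e * u + 1) / (e + 1)))))) / b)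

theorem int_Lb (u e : ℝ) (hu : 0 < u) (he : 0 < e) (hu1 : u ≠ 1) :
    ∫⁻ b in Set.Ioi (0:ℝ), Lb u b e = Phi u e := by
  have hr : 0 < (e * u + 1) / (e + 1) := by positivity
  have key : ∫⁻ b in Set.Ioi (0:ℝ), ENNReal.ofReal (Real.log ((1 + b * u) * (1 + b) / ((1 + b * ((e * u + 1) / (e + 1))) * (1 + b * (u / ((e * u + 1) / (e + 1)))))) / b)
     = ENNReal.ofReal (Real.log ((e * u + 1) / (e + 1)) * Real.log (u / ((e * u + 1) / (e + 1)))) := by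
    have hs : 0 < u / ((e * u + 1) / (e + 1)) := by positivity
    have hrs : ((e * u + 1) / (e + 1)) * (u / ((e * u + 1) / (e + 1))) = u := by field_simp
    have hlr : (e * u + 1) / (e + 1) < 1 ↔ u < 1 := by
      rw [div_lt_one (by positivity)]
      constructor
      · intro h; nlinarith
      · intro h; nlinarith
    have hls : u / ((e * u + 1) / (e + 1)) < 1 ↔ u < 1 := by
      rw [div_lt_one (by positivity), lt_div_iff₀ (by positivity)]
      constructor
      · intro h; nlinarith
      · intro h; nlinarith
    have hlr' : 1 < (e * u + 1) / (e + 1) ↔ 1 < u := by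
      rw [one_lt_div (by positivity)]
      constructor
      · intro h; nlinarith
      · intro h; nlinarith
    have hls' : 1 < u / ((e * u + 1) / (e + 1)) ↔ 1 < u := by
      rw [one_lt_div (by positivity), div_lt_iff₀ (by positivity)]
      constructor
      · intro h; nlinarith
      · intro h; nlinarith
    generalize (e * u + 1) / (e + 1) = r at *
    generalize u / r = s at *
    subst hrs
    rcases lt_or_gt_of_ne hu1 with h | h
    · have := int_corner r 1 s 1 hr (hlr.2 h) hs (hls.2 h)
      simp only [one_div, Real.log_inv, mul_one, neg_mul_neg] at this
      rw [← this]
      congr 1; ext b; congr 4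
      ring
    · have := int_corner 1 r 1 s one_pos (hlr'.2 h) one_pos (hls'.2 h)
      simp only [div_one, mul_one] at this
      rw [← this]
      congr 1; ext b; congr 3 <;> ring
  unfold Lb
  rw [lintegral_const_mul _ (by fun_prop), key, ← ENNReal.ofReal_mul (by positivity)]
  unfold Phi
  congr 1
  field_simp

def psiP (a b c d e : ℝ) : ℝ := ((a+e)*(b+1)+c*(a+b+e+1)) * d + (c*((a+b)*(e+1)) + (a*b*(e+1)+e*(a+b)))

theorem inner (u b e : ℝ) (hu : 0 < u) (hb : 0 < b) (he : 0 < e) (hu1 : u ≠ 1) :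
    ENNReal.ofReal (b * e) * ∫⁻ c in Set.Ioi (0:ℝ), ∫⁻ d in Set.Ioi (0:ℝ), ENNReal.ofReal ((psiP (b * e * u) b c d e ^ 2)⁻¹)
      = Lb u b e := by
  have hu2 : (1 - u) ^ 2 > 0 := by
    have : 1 - u ≠ 0 := fun h => hu1 (by linarith)
    positivity
  obtain ⟨a, ha⟩ : ∃ a, a = b * e * u := ⟨_, rfl⟩
  have ha0 : 0 < a := by rw [ha]; positivity
  have h1 : ∀ c ∈ Set.Ioi (0:ℝ), ∫⁻ d in Set.Ioi (0:ℝ), ENNReal.ofReal ((psiP a b c d e ^ 2)⁻¹) =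
      ENNReal.ofReal ((((a + b + e + 1) * c + (a+e)*(b+1)) * ((a+b)*(e+1) * c + (a*b*(e+1)+e*(a+b))))⁻¹) := by
    intro c hc
    have hc : 0 < c := hc
    unfold psiP
    rw [int_sq _ _ (by positivity) (by positivity)]
    congr 2
    ring
  have hD : (a + e) * (b + 1) * ((a + b) * (e + 1)) - (a + b + e + 1) * (a*b*(e+1)+e*(a+b)) = (b * e) ^ 2 * (1 - u) ^ 2 := by
    rw [ha]; ring
  rw [← ha, setLIntegral_congr_fun measurableSet_Ioi h1, int_two _ _ _ _ (by positivity) (by positivity) (by positivity) (by positivity)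
    (by have : (b * e) ^ 2 * (1 - u) ^ 2 > 0 := by positivity
        linarith), hD, ← ENNReal.ofReal_mul (by positivity)]
  unfold Lb
  rw [← ENNReal.ofReal_mul (by positivity)]
  have hR : (a + e) * (b + 1) * ((a + b) * (e + 1)) / ((a + b + e + 1) * (a*b*(e+1)+e*(a+b))) =
     (1 + b * u) * (1 + b) / ((1 + b * ((e * u + 1) / (e + 1))) * (1 + b * (u / ((e * u + 1) / (e + 1))))) := by
    have e1 : 1 + b * ((e * u + 1) / (e + 1)) = (a + b + e + 1) / (e + 1) := by rw [ha]; field_simp; ring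
    have e2 : 1 + b * (u / ((e * u + 1) / (e + 1))) = (a*b*(e+1)+e*(a+b)) / (b * e * (e * u + 1)) := by rw [ha]; field_simp; ring
    have e3 : a + e = e * (1 + b * u) := by rw [ha]; ring
    have e4 : a + b = b * (e * u + 1) := by rw [ha]; ring
    rw [e1, e2, e3, e4]
    field_simp
    ring
  rw [hR]
  congr 1
  field_simp

theorem inner_a (b e : ℝ) (hb : 0 < b) (he : 0 < e) :
    ∫⁻ a in Set.Ioi (0:ℝ), ∫⁻ c in Set.Ioi (0:ℝ), ∫⁻ d in Set.Ioi (0:ℝ), ENNReal.ofReal ((psiP a b c d e ^ 2)⁻¹)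
      = ∫⁻ u in Set.Ioi (0:ℝ), Lb u b e := by
  rw [sub_scale (b * e) (by positivity)]
  apply lintegral_congr_ae
  rw [Filter.EventuallyEq, ae_restrict_iff' measurableSet_Ioi]
  have : ∀ᵐ u : ℝ, u ≠ 1 := by simp [ae_iff]
  filter_upwards [this] with u hu1 hu
  exact inner u b e hu hb he hu1

theorem meas_Lb : Measurable (fun p : ℝ × ℝ × ℝ => Lb p.1 p.2.1 p.2.2) := by
  unfold Lb; fun_prop

theorem meas_Phi : Measurable (fun p : ℝ × ℝ => Phi p.1 p.2) := by
  unfold Phi; fun_prop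

theorem big : ∫⁻ e in Set.Ioi (0:ℝ), ∫⁻ b in Set.Ioi (0:ℝ), ∫⁻ a in Set.Ioi (0:ℝ), ∫⁻ c in Set.Ioi (0:ℝ), ∫⁻ d in Set.Ioi (0:ℝ), ENNReal.ofReal ((psiP a b c d e ^ 2)⁻¹) = 6 * zz := by
  rw [← D3, lintegral_lintegral_swap (f := Phi) (meas_Phi.aemeasurable)]
  apply setLIntegral_congr_fun measurableSet_Ioi
  intro e he
  simp only
  rw [setLIntegral_congr_fun measurableSet_Ioi (fun b hb => inner_a b e hb he), lintegral_lintegral_swap]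
  swap
  · apply Measurable.aemeasurable
    exact meas_Lb.comp (by fun_prop : Measurable (fun p : ℝ × ℝ => (p.2, p.1, e)))
  apply lintegral_congr_ae
  rw [Filter.EventuallyEq, ae_restrict_iff' measurableSet_Ioi]
  have : ∀ᵐ u : ℝ, u ≠ 1 := by simp [ae_iff]
  filter_upwards [this] with u hu1 hu
  exact int_Lb u e hu he hu1

theorem pi_step (n : ℕ) (μ : Measure ℝ) [SigmaFinite μ] (i : Fin (n+1)) (F : (Fin (n+1) → ℝ) → ENNReal) (hF : Measurable F) :
    ∫⁻ y, F y ∂(Measure.pi fun _ => μ) = ∫⁻ x, ∫⁻ z, F (i.insertNth (α := fun _ => ℝ) x z) ∂(Measure.pi fun _ => μ) ∂μ := by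
  have h := ((measurePreserving_piFinSuccAbove (fun _ : Fin (n+1) => μ) i).symm)
  rw [← h.lintegral_comp hF, lintegral_prod]
  · rfl
  · exact (hF.comp (MeasurableEquiv.measurable _)).aemeasurable

theorem pi_five (μ : Measure ℝ) [SigmaFinite μ] (F : (Fin 5 → ℝ) → ENNReal) (hF : Measurable F) :
    ∫⁻ y, F y ∂(Measure.pi fun _ => μ) = ∫⁻ e, ∫⁻ b, ∫⁻ a, ∫⁻ c, ∫⁻ d, F ![a,b,c,d,e] ∂μ ∂μ ∂μ ∂μ ∂μ := by
  have m (n : ℕ) (i : Fin (n+1)) (x : ℝ) : Measurable (fun z : Fin n → ℝ => i.insertNth (α := fun _ => ℝ) x z) := by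
    apply measurable_pi_lambda
    intro j
    refine Fin.succAboveCases i ?_ ?_ j
    · simp
    · intro k; simp; fun_prop
  rw [pi_step 4 μ 4 F hF]
  congr 1; ext e
  have h1 := hF.comp (m 4 4 e)
  refine (pi_step 3 μ 1 _ h1).trans ?_
  congr 1; ext b
  have h2 := h1.comp (m 3 1 b)
  refine (pi_step 2 μ 0 _ h2).trans ?_
  congr 1; ext a
  have h3 := h2.comp (m 2 0 a)
  refine (pi_step 1 μ 0 _ h3).trans ?_
  congr 1; ext c
  have h4 := h3.comp (m 1 0 c)
  refine (pi_step 0 μ 0 _ h4).trans ?_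
  congr 1; ext d
  rw [Measure.pi_of_empty, lintegral_dirac]
  simp only [Function.comp]
  congr 1
  ext j
  fin_cases j <;> rfl

theorem psi_eq' (y : Fin 5 → ℝ) : psiI edK4 (Fin.snoc y 1) = psiP (y 0) (y 1) (y 2) (y 3) (y 4) := by
  have h : y = ![y 0, y 1, y 2, y 3, y 4] := by
    ext j; fin_cases j <;> rfl
  conv_lhs => rw [h]
  rw [psi_eq]
  rfl

/-- The period of the wheel with three spokes `W₃ = K₄`: the projective integral of
`ψ_{K₄}^{-2}` over the affine chart `α₆ = 1` is absolutely convergent and equals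
`6 ζ(3)`. -/
theorem statement0 :
    IntegrableOn (fun y : Fin 5 → ℝ => ((psiI edK4 (Fin.snoc y 1)) ^ 2)⁻¹)
        (posOrthant 5) volume ∧
      ∫ y in posOrthant 5, ((psiI edK4 (Fin.snoc y 1)) ^ 2)⁻¹
        = 6 * ∑' n : ℕ, (1 : ℝ) / (n + 1) ^ 3 := by
  simp only [psi_eq']
  have hm : Measurable (fun y : Fin 5 → ℝ => (psiP (y 0) (y 1) (y 2) (y 3) (y 4) ^ 2)⁻¹) := by
    unfold psiP; fun_prop
  have hI : ∫⁻ y in posOrthant 5, ENNReal.ofReal ((psiP (y 0) (y 1) (y 2) (y 3) (y 4) ^ 2)⁻¹) =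
      ENNReal.ofReal (6 * ∑' n : ℕ, (1 : ℝ) / (n + 1) ^ 3) := by
    rw [ENNReal.ofReal_mul (by norm_num), ← zz_eq, posOrthant, volume_pi, Measure.restrict_pi_pi,
      pi_five _ _ hm.ennreal_ofReal]
    refine Eq.trans ?_ (big.trans ?_)
    · rfl
    · norm_num
  have hnn : ∀ y : Fin 5 → ℝ, 0 ≤ (psiP (y 0) (y 1) (y 2) (y 3) (y 4) ^ 2)⁻¹ := fun y => by positivity
  constructor
  · rw [IntegrableOn, ← lintegral_ofReal_ne_top_iff_integrable hm.aestronglyMeasurable (Filter.Eventually.of_forall hnn), hI]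
    exact ENNReal.ofReal_ne_top
  · rw [integral_eq_lintegral_of_nonneg_ae (Filter.Eventually.of_forall hnn) hm.aestronglyMeasurable, hI, ENNReal.toReal_ofReal]
    have : 0 ≤ ∑' n : ℕ, (1 : ℝ) / (n + 1) ^ 3 := tsum_nonneg (fun n => by positivity)
    positivity
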